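/- Fix R > 0 and define ρ₂ : ℝ → ℝ by ρ₂(d) = 0 if d > R, ρ₂(d) = (1/(πR²))[R²·arccos(d/R) - d·√(R² - d²)] if -R ≤ d ≤ R, and ρ₂(d) = 1 if d < -R. Then ρ₂ is continuously differentiable on ℝ, with derivative ρ₂'(d) = -(2/(πR²))·√(R² - d²) for -R ≤ d ≤ R and ρ₂'(d) = 0 for |d| > R. -/

import Mathlib

open Real

/-- The 2-dimensional projected density of the geometry projection method:
the area fraction of a sampling disk of radius `R` cut by a straight boundary
at signed distance `d` from the disk center. -/
noncomputable def rho2 (R d : ℝ) : ℝ :=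
  if R < d then 0
  else if d < -R then 1
  else (1 / (π * R ^ 2)) * (R ^ 2 * Real.arccos (d / R) - d * Real.sqrt (R ^ 2 - d ^ 2))

/-- The closed formula for `rho2` on the central interval is valid on all of `ℝ`, because
`Real.arccos` and `Real.sqrt` are constant beyond the ends of their natural domains. -/
lemma rho2_eq {R : ℝ} (hR : 0 < R) (d : ℝ) :
    rho2 R d = (1 / (π * R ^ 2)) *
      (R ^ 2 * Real.arccos (d / R) - d * Real.sqrt (R ^ 2 - d ^ 2)) := by
  unfold rho2
  split_ifs with h₁ h₂
  · rw [Real.arccos_of_one_le ((one_le_div hR).2 h₁.le),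
      Real.sqrt_eq_zero_of_nonpos (by nlinarith)]
    simp
  · rw [Real.arccos_of_le_neg_one ((div_le_iff₀ hR).2 (by linarith)),
      Real.sqrt_eq_zero_of_nonpos (by nlinarith)]
    have := Real.pi_ne_zero
    field_simp
    simp
  · rfl

lemma continuous_rho2 {R : ℝ} (hR : 0 < R) : Continuous (rho2 R) := by
  rw [funext (rho2_eq hR)]
  fun_prop

lemma hasDerivAt_rho2_of_ne {R : ℝ} (hR : 0 < R) {d : ℝ} (h₁ : d ≠ -R) (h₂ : d ≠ R) :
    HasDerivAt (rho2 R) (-(2 / (π * R ^ 2)) * Real.sqrt (R ^ 2 - d ^ 2)) d := by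
  have hne : R ^ 2 - d ^ 2 ≠ 0 := by
    rw [sq_sub_sq]
    exact mul_ne_zero (fun h => h₁ (by linarith)) (fun h => h₂ (by linarith))
  have harccos := (Real.hasDerivAt_arccos (x := d / R)
    (fun h => h₁ (by rw [div_eq_iff hR.ne'] at h; linarith))
    (fun h => h₂ (by rw [div_eq_iff hR.ne'] at h; linarith))).comp d
      ((hasDerivAt_id d).div_const R)
  have hsqrt := (((hasDerivAt_id d).pow 2).const_sub (R ^ 2)).sqrt hne
  have key := ((harccos.const_mul (R ^ 2)).sub ((hasDerivAt_id d).mul hsqrt)).const_mul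
    (1 / (π * R ^ 2))
  rw [funext (rho2_eq hR)]
  refine key.congr_deriv ?_
  have hs : √(1 - (d / R) ^ 2) = √(R ^ 2 - d ^ 2) / R := by
    rw [show 1 - (d / R) ^ 2 = (R ^ 2 - d ^ 2) / R ^ 2 by field_simp,
      Real.sqrt_div' _ (sq_nonneg R), Real.sqrt_sq hR.le]
  have hdiv := Real.div_sqrt (x := R ^ 2 - d ^ 2)
  simp only [id, hs, Pi.pow_apply]
  generalize √(R ^ 2 - d ^ 2) = s at hdiv
  rw [one_div_div]
  have hcancel : R / s * (1 / R) = 1 / s := by field_simp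
  linear_combination (-(1 / (π * R ^ 2))) * hdiv - (1 / (π * R ^ 2)) * R ^ 2 * hcancel

/-- A continuous function whose derivative agrees with a continuous function off a countable set
is differentiable everywhere, with that derivative. -/
lemma hasDerivAt_of_hasDerivAt_off_countable {f g : ℝ → ℝ} {s : Set ℝ} (hs : s.Countable)
    (hf : Continuous f) (hg : Continuous g) (h : ∀ x ∉ s, HasDerivAt f (g x) x) (x : ℝ) :
    HasDerivAt f (g x) x := by
  have hfg : f = fun y => f x + ∫ t in x..y, g t := by
    ext y
    rw [MeasureTheory.integral_eq_of_hasDerivAt_off_countable f g hs hf.continuousOn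
      (fun t ht => h t ht.2) (hg.intervalIntegrable x y)]
    ring
  rw [hfg]
  exact (hg.integral_hasStrictDerivAt x x).hasDerivAt.const_add (f x)

lemma hasDerivAt_rho2 {R : ℝ} (hR : 0 < R) (d : ℝ) :
    HasDerivAt (rho2 R) (-(2 / (π * R ^ 2)) * Real.sqrt (R ^ 2 - d ^ 2)) d := by
  refine hasDerivAt_of_hasDerivAt_off_countable
    (g := fun d => -(2 / (π * R ^ 2)) * Real.sqrt (R ^ 2 - d ^ 2))
    (s := {-R, R}) (Set.toFinite _).countable (continuous_rho2 hR) (by fun_prop) ?_ d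
  intro x hx
  simp only [Set.mem_insert_iff, Set.mem_singleton_iff, not_or] at hx
  exact hasDerivAt_rho2_of_ne hR hx.1 hx.2

/-- The 2-dimensional projected density is continuously differentiable on `ℝ`, with
derivative `-(2/(πR²))·√(R² - d²)` for `-R ≤ d ≤ R` and `0` for `|d| > R`. -/
theorem rho2_contDiff_and_deriv (R : ℝ) (hR : 0 < R) :
    ContDiff ℝ 1 (rho2 R) ∧
    (∀ d : ℝ, -R ≤ d → d ≤ R →
      HasDerivAt (rho2 R) (-(2 / (π * R ^ 2)) * Real.sqrt (R ^ 2 - d ^ 2)) d) ∧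
    (∀ d : ℝ, R < |d| → HasDerivAt (rho2 R) 0 d) := by
  refine ⟨contDiff_one_iff_deriv.2 ⟨fun d => (hasDerivAt_rho2 hR d).differentiableAt, ?_⟩,
    fun d _ _ => hasDerivAt_rho2 hR d, fun d hd => ?_⟩
  · rw [funext fun d => (hasDerivAt_rho2 hR d).deriv]
    fun_prop
  · have hsq : R ^ 2 - d ^ 2 ≤ 0 := by
      rw [← sq_abs d]
      nlinarith
    simpa [Real.sqrt_eq_zero_of_nonpos hsq] using hasDerivAt_rho2 hR d
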